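/- Let h_{ab} : ℝ⁴ → ℝ be smooth and symmetric, let ξ_a : ℝ⁴ → ℝ be smooth, and set h̃_{ab} := h_{ab} + ∂_a ξ_b + ∂_b ξ_a. With the null frame K = ∂_t − ∂_x, Q = ∂_y + i∂_z, ∇_v := v^a∂_a, and subscripts denoting contraction with frame vectors via ℂ-bilinear extension, one has at every point of ℝ⁴: ∇_K h̃_{QQ} − 2∇_Q h̃_{KQ} = ∇_K h_{QQ} − 2∇_Q h_{KQ} − 2∇_Q∇_Q ξ_K, where ξ_K := K^aξ_a. In particular, the shear combination ∇_Kh_{QQ} − 2∇_Qh_{KQ} is NOT gauge invariant: it changes by −2∇_Q²ξ_K. -/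

import Mathlib

noncomputable section

/-- Real partial derivative `∂_a f` on `ℝ⁴ = Fin 4 → ℝ`. -/
def pd (a : Fin 4) (f : (Fin 4 → ℝ) → ℝ) : (Fin 4 → ℝ) → ℝ :=
  fun x => fderiv ℝ f x (Pi.single a 1)

/-- Complex-valued partial derivative `∂_a f` on `ℝ⁴`. -/
def pdC (a : Fin 4) (f : (Fin 4 → ℝ) → ℂ) : (Fin 4 → ℝ) → ℂ :=
  fun x => fderiv ℝ f x (Pi.single a 1)

/-- Null frame vector `K = ∂_t − ∂_x`. -/
def Kv : Fin 4 → ℂ := ![1, -1, 0, 0]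
/-- Null frame vector `Q = ∂_y + i ∂_z`. -/
def Qv : Fin 4 → ℂ := ![0, 0, 1, Complex.I]

/-- Directional derivative `∇_v f = v^a ∂_a f` (ℂ-bilinear extension). -/
def nab (v : Fin 4 → ℂ) (f : (Fin 4 → ℝ) → ℂ) : (Fin 4 → ℝ) → ℂ :=
  fun x => ∑ a, v a * pdC a f x

/-- Frame contraction `h_{vw} = v^a w^b h_{ab}` (ℂ-bilinear extension). -/
def contr2 (h : Fin 4 → Fin 4 → (Fin 4 → ℝ) → ℝ) (v w : Fin 4 → ℂ) :
    (Fin 4 → ℝ) → ℂ :=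
  fun x => ∑ a, ∑ b, v a * w b * (h a b x : ℂ)

/-- Frame contraction `ξ_v = v^a ξ_a` (ℂ-bilinear extension). -/
def contr1 (ξ : Fin 4 → (Fin 4 → ℝ) → ℝ) (v : Fin 4 → ℂ) : (Fin 4 → ℝ) → ℂ :=
  fun x => ∑ a, v a * (ξ a x : ℂ)

lemma pd_diff (a : Fin 4) (f : (Fin 4 → ℝ) → ℝ) (hf : ContDiff ℝ (⊤ : ℕ∞) f) :
    Differentiable ℝ (pd a f) := by
  have h1 : ContDiff ℝ 1 (fderiv ℝ f) :=
    hf.fderiv_right (by norm_cast)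
  have h2 : Differentiable ℝ (fderiv ℝ f) := h1.differentiable (by norm_num)
  unfold pd
  fun_prop

lemma pd_comm (a b : Fin 4) (f : (Fin 4 → ℝ) → ℝ) (hf : ContDiff ℝ (⊤ : ℕ∞) f)
    (x : Fin 4 → ℝ) : pd a (pd b f) x = pd b (pd a f) x := by
  have h1 : ContDiff ℝ 1 (fderiv ℝ f) :=
    hf.fderiv_right (by norm_cast)
  have h2 : Differentiable ℝ (fderiv ℝ f) := h1.differentiable (by norm_num)
  have key : ∀ v w : Fin 4 → ℝ,
      fderiv ℝ (fun y => fderiv ℝ f y v) x w = fderiv ℝ (fderiv ℝ f) x w v := by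
    intro v w
    rw [fderiv_clm_apply (h2 x) (differentiableAt_const v)]
    simp
  have hs : IsSymmSndFDerivAt ℝ f x :=
    hf.contDiffAt.isSymmSndFDerivAt (by simp; norm_cast)
  unfold pd
  rw [key, key]
  exact hs _ _

lemma pdC_ofReal (f : (Fin 4 → ℝ) → ℝ) (hf : Differentiable ℝ f)
    (x : Fin 4 → ℝ) : HasFDerivAt (fun y => (f y : ℂ)) (Complex.ofRealCLM.comp (fderiv ℝ f x)) x :=
  Complex.ofRealCLM.hasFDerivAt.comp x (hf x).hasFDerivAt

lemma pdC_sum {ι : Type} [Fintype ι] (a : Fin 4) (c : ι → ℂ) (f : ι → (Fin 4 → ℝ) → ℝ)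
    (hf : ∀ i, Differentiable ℝ (f i)) (x : Fin 4 → ℝ) :
    pdC a (fun y => ∑ i, c i * (f i y : ℂ)) x = ∑ i, c i * (pd a (f i) x : ℂ) := by
  have h := HasFDerivAt.fun_sum (u := Finset.univ)
    (fun i _ => (pdC_ofReal (f i) (hf i) x).const_mul (c i))
  unfold pdC pd
  rw [h.fderiv]
  simp

lemma nab_contr1 (v w : Fin 4 → ℂ) (ξ : Fin 4 → (Fin 4 → ℝ) → ℝ)
    (hξ : ∀ a, Differentiable ℝ (ξ a)) :
    nab v (contr1 ξ w) = contr2 (fun a b => pd a (ξ b)) v w := by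
  funext x
  unfold nab contr1 contr2
  simp_rw [pdC_sum _ w ξ hξ, Finset.mul_sum, mul_assoc]

lemma nab_contr2 (v u w : Fin 4 → ℂ) (h : Fin 4 → Fin 4 → (Fin 4 → ℝ) → ℝ)
    (hh : ∀ a b, Differentiable ℝ (h a b)) (x : Fin 4 → ℝ) :
    nab v (contr2 h u w) x = ∑ a, v a * ∑ b, ∑ c, u b * w c * (pd a (h b c) x : ℂ) := by
  unfold nab contr2
  refine Finset.sum_congr rfl fun a _ => ?_
  have := pdC_sum a (fun p : Fin 4 × Fin 4 => u p.1 * w p.2) (fun p => h p.1 p.2)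
    (fun p => hh _ _) x
  simp only [Fintype.sum_prod_type] at this
  rw [this]

/-- Under the infinitesimal coordinate transformation `h̃_{ab} = h_{ab} + ∂_a ξ_b + ∂_b ξ_a`,
the shear combination transforms as
`∇_K h̃_{QQ} − 2∇_Q h̃_{KQ} = ∇_K h_{QQ} − 2∇_Q h_{KQ} − 2∇_Q∇_Q ξ_K`:
it is NOT gauge invariant, changing by `−2∇_Q² ξ_K`. -/
theorem shear_boundary_data_not_gauge_invariant
    (h : Fin 4 → Fin 4 → (Fin 4 → ℝ) → ℝ)
    (hsmooth : ∀ a b, ContDiff ℝ (⊤ : ℕ∞) (h a b))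
    (hsymm : ∀ a b x, h a b x = h b a x)
    (ξ : Fin 4 → (Fin 4 → ℝ) → ℝ) (hξ : ∀ a, ContDiff ℝ (⊤ : ℕ∞) (ξ a))
    (ht : Fin 4 → Fin 4 → (Fin 4 → ℝ) → ℝ)
    (hht : ∀ a b x, ht a b x = h a b x + pd a (ξ b) x + pd b (ξ a) x) :
    ∀ x : Fin 4 → ℝ,
      nab Kv (contr2 ht Qv Qv) x - 2 * nab Qv (contr2 ht Kv Qv) x
        = nab Kv (contr2 h Qv Qv) x - 2 * nab Qv (contr2 h Kv Qv) x
          - 2 * nab Qv (nab Qv (contr1 ξ Kv)) x := by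
  intro x
  have dξ : ∀ a, Differentiable ℝ (ξ a) := fun a => (hξ a).differentiable (by simp)
  have dh : ∀ a b, Differentiable ℝ (h a b) := fun a b => (hsmooth a b).differentiable (by simp)
  have dp : ∀ a b, Differentiable ℝ (pd a (ξ b)) := fun a b => pd_diff a _ (hξ b)
  have e : ∀ a b, ht a b = fun x => h a b x + pd a (ξ b) x + pd b (ξ a) x :=
    fun a b => funext (hht a b)
  have dt : ∀ a b, Differentiable ℝ (ht a b) := by
    intro a b
    rw [e]
    exact ((dh a b).add (dp a b)).add (dp b a)
  have pt : ∀ a b c, pd a (ht b c) x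
      = pd a (h b c) x + pd a (pd b (ξ c)) x + pd a (pd c (ξ b)) x := by
    intro a b c
    rw [e]
    have := (((dh b c x).hasFDerivAt.add (dp b c x).hasFDerivAt).add
      (dp c b x).hasFDerivAt).fderiv
    exact congrArg (fun L => L (Pi.single a 1)) this
  rw [nab_contr1 _ _ _ dξ, nab_contr2 _ _ _ _ dt, nab_contr2 _ _ _ _ dt,
    nab_contr2 _ _ _ _ dh, nab_contr2 _ _ _ _ dh, nab_contr2 _ _ _ _ dp]
  simp only [pt, Fin.sum_univ_four]
  simp [Kv, Qv]
  rw [pd_comm 2 0 _ (hξ 2), pd_comm 2 0 _ (hξ 3), pd_comm 2 1 _ (hξ 2), pd_comm 2 1 _ (hξ 3),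
    pd_comm 3 0 _ (hξ 2), pd_comm 3 0 _ (hξ 3), pd_comm 3 1 _ (hξ 2), pd_comm 3 1 _ (hξ 3)]
  ring_nf
  simp only [Complex.I_sq]
  ring

end
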